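/- Block recovery lemma: let j ∈ ℕ and let g : ℤ₂ → ℝ be a function that is constant on each set Q_{j+1,k} for 0 ≤ k < 2^{j+1} and satisfies ∫_{Q_{j,k}} g dμ = 0 for every 0 ≤ k < 2^j. Then S_i g = 0 for every i ≤ j and S_i g = g for every i ≥ j + 1; consequently Δ_j g = g and Δ_i g = 0 for every i ≠ j. -/

import Mathlib

open MeasureTheory

noncomputable section

instance : MeasurableSpace (PadicInt 2) := borel _
instance : BorelSpace (PadicInt 2) := ⟨rfl⟩

/-- The Haar measure on `ℤ₂`, normalized so that `μ (Set.univ) = 1`. -/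
def μ : Measure (PadicInt 2) :=
  Measure.addHaarMeasure
    ⟨⟨Set.univ, isCompact_univ⟩, by simp⟩

/-- The coset `k + 2^j ℤ₂` as a ball. -/
def Q (j k : ℕ) : Set (PadicInt 2) :=
  {x : PadicInt 2 | ‖x - (k : PadicInt 2)‖ ≤ (2 : ℝ) ^ (-(j : ℤ))}

/-- The average of `f` on the ball of radius `2 ^ (-j)` around `x`. -/
def S (j : ℕ) (f : PadicInt 2 → ℝ) (x : PadicInt 2) : ℝ :=
  (2 : ℝ) ^ j * ∫ y in {y : PadicInt 2 | ‖y - x‖ ≤ (2 : ℝ) ^ (-(j : ℤ))}, f y ∂μ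

/-- The dyadic block `Δ_j f = S_{j+1} f - S_j f`. -/
def Δ (j : ℕ) (f : PadicInt 2 → ℝ) : PadicInt 2 → ℝ :=
  fun x => S (j + 1) f x - S j f x

namespace PadicInt

/-- The closed ball of radius `2 ^ (-n)` around `x`, in the form used to define `S`. -/
abbrev dyadicBall (n : ℕ) (x : PadicInt 2) : Set (PadicInt 2) :=
  {y : PadicInt 2 | ‖y - x‖ ≤ (2 : ℝ) ^ (-(n : ℤ))}

lemma mem_dyadicBall_iff_dvd {n : ℕ} {x y : PadicInt 2} :
    y ∈ dyadicBall n x ↔ (2 : PadicInt 2) ^ n ∣ y - x := by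
  have h := norm_le_pow_iff_mem_span_pow (p := 2) (y - x) n
  rw [Ideal.mem_span_singleton] at h
  exact_mod_cast h

lemma self_mem_dyadicBall (n : ℕ) (x : PadicInt 2) : x ∈ dyadicBall n x := by
  simp

lemma dyadicBall_subset {m n : ℕ} (h : m ≤ n) (x : PadicInt 2) :
    dyadicBall n x ⊆ dyadicBall m x := fun y hy => by
  rw [mem_dyadicBall_iff_dvd] at hy ⊢
  exact (pow_dvd_pow 2 h).trans hy

lemma dyadicBall_eq_of_mem {n : ℕ} {x y : PadicInt 2} (h : y ∈ dyadicBall n x) :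
    dyadicBall n y = dyadicBall n x := by
  ext z
  rw [mem_dyadicBall_iff_dvd] at h ⊢
  rw [mem_dyadicBall_iff_dvd, ← sub_add_sub_cancel z y x]
  exact (dvd_add_left h).symm

lemma measurableSet_dyadicBall (n : ℕ) (x : PadicInt 2) : MeasurableSet (dyadicBall n x) :=
  (isClosed_le (by fun_prop) continuous_const).measurableSet

lemma dyadicBall_mem_nhds (n : ℕ) (x : PadicInt 2) : dyadicBall n x ∈ nhds x := by
  have h := Metric.closedBall_mem_nhds x (show (0 : ℝ) < 2 ^ (-(n : ℤ)) by positivity)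
  filter_upwards [h] with y hy
  rwa [Metric.mem_closedBall, dist_eq_norm] at hy

lemma exists_dyadicBall_eq_Q (n : ℕ) (x : PadicInt 2) :
    ∃ k < 2 ^ n, dyadicBall n x = Q n k := by
  refine ⟨x.appr n, x.appr_lt n, dyadicBall_eq_of_mem ?_⟩
  rw [mem_dyadicBall_iff_dvd, ← Ideal.mem_span_singleton]
  exact_mod_cast x.appr_spec n

lemma not_two_dvd_one : ¬ (2 : PadicInt 2) ∣ 1 := fun h =>
  prime_p (p := 2) |>.not_isUnit (isUnit_of_dvd_one (by exact_mod_cast h))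

lemma two_dvd_or_two_dvd_sub_one (t : PadicInt 2) : 2 ∣ t ∨ 2 ∣ t - 1 := by
  have h := t.appr_spec 1
  have hlt := t.appr_lt 1
  rw [Ideal.mem_span_singleton] at h
  generalize t.appr 1 = k at h hlt
  interval_cases k
  · left; simpa using h
  · right; simpa using h

lemma dyadicBall_eq_union (n : ℕ) (x : PadicInt 2) :
    dyadicBall n x = dyadicBall (n + 1) x ∪ dyadicBall (n + 1) (x + 2 ^ n) := by
  ext y
  simp only [Set.mem_union, mem_dyadicBall_iff_dvd]
  constructor
  · rintro ⟨t, ht⟩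
    rw [← sub_sub, ht, pow_succ, show (2 : PadicInt 2) ^ n * t - 2 ^ n = 2 ^ n * (t - 1) by ring]
    exact (two_dvd_or_two_dvd_sub_one t).imp (mul_dvd_mul_left _) (mul_dvd_mul_left _)
  · rintro (h | h)
    · exact (pow_dvd_pow 2 n.le_succ).trans h
    · rw [← sub_sub] at h
      exact (dvd_sub_left dvd_rfl).1 ((pow_dvd_pow 2 n.le_succ).trans h)

lemma disjoint_dyadicBall (n : ℕ) (x : PadicInt 2) :
    Disjoint (dyadicBall (n + 1) x) (dyadicBall (n + 1) (x + 2 ^ n)) := by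
  rw [Set.disjoint_left]
  intro y h₁ h₂
  rw [mem_dyadicBall_iff_dvd] at h₁ h₂
  have h := dvd_sub h₁ h₂
  rw [show y - x - (y - (x + 2 ^ n)) = (2 : PadicInt 2) ^ n * 1 by ring, pow_succ] at h
  exact not_two_dvd_one ((mul_dvd_mul_iff_left (pow_ne_zero n two_ne_zero)).1 h)

instance : μ.IsAddHaarMeasure := by unfold μ; infer_instance

instance : IsProbabilityMeasure μ := ⟨Measure.addHaarMeasure_self⟩

lemma measureReal_dyadicBall (n : ℕ) (x : PadicInt 2) :
    μ.real (dyadicBall n x) = ((2 : ℝ) ^ n)⁻¹ := by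
  have translate (m : ℕ) (y : PadicInt 2) :
      μ.real (dyadicBall m y) = μ.real (dyadicBall m 0) := by
    have h : (fun z => z + -y) ⁻¹' dyadicBall m 0 = dyadicBall m y := by
      ext z; simp [sub_eq_add_neg]
    rw [← h, measureReal_def, measure_preimage_add_right, measureReal_def]
  induction n generalizing x with
  | zero =>
    have h : dyadicBall 0 x = Set.univ := by
      ext y; simp [PadicInt.norm_le_one]
    simp [h]
  | succ n ih =>
    have h := ih x
    rw [dyadicBall_eq_union, measureReal_union (disjoint_dyadicBall n x)
      (measurableSet_dyadicBall _ _), translate, translate (n + 1) (x + 2 ^ n)] at h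
    rw [translate, pow_succ, _root_.mul_inv, ← h]
    ring

lemma setIntegral_dyadicBall_eq_zero {f : PadicInt 2 → ℝ} (hf : Integrable f μ) {i j : ℕ}
    (hij : i ≤ j) (h : ∀ x, ∫ y in dyadicBall j x, f y ∂μ = 0) (x : PadicInt 2) :
    ∫ y in dyadicBall i x, f y ∂μ = 0 := by
  induction hij using Nat.decreasingInduction generalizing x with
  | self => exact h x
  | of_succ i _ ih =>
    rw [dyadicBall_eq_union, setIntegral_union (disjoint_dyadicBall i x)
      (measurableSet_dyadicBall _ _) hf.integrableOn hf.integrableOn, ih, ih, add_zero]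

lemma S_eq_self_of_const {f : PadicInt 2 → ℝ} {i : ℕ} {x : PadicInt 2}
    (h : ∀ y ∈ dyadicBall i x, f y = f x) : S i f x = f x := by
  rw [S, setIntegral_congr_fun (measurableSet_dyadicBall i x) h, setIntegral_const,
    measureReal_dyadicBall, smul_eq_mul, mul_inv_cancel_left₀ (by positivity)]

lemma continuous_of_const_dyadicBall {f : PadicInt 2 → ℝ} (n : ℕ)
    (h : ∀ x, ∀ y ∈ dyadicBall n x, f y = f x) : Continuous f :=
  IsLocallyConstant.continuous <| (IsLocallyConstant.iff_eventually_eq f).2 fun x =>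
    Filter.mem_of_superset (dyadicBall_mem_nhds n x) (h x)

end PadicInt

open PadicInt

/-- Block recovery lemma: if `g` is constant on each `Q (j+1) k` and has zero mean on each
`Q j k`, then `S i g = 0` for `i ≤ j`, `S i g = g` for `i ≥ j + 1`, hence `Δ j g = g` and
`Δ i g = 0` for `i ≠ j`. -/
theorem block_recovery (j : ℕ) (g : PadicInt 2 → ℝ)
    (hconst : ∀ k < 2 ^ (j + 1), ∀ x ∈ Q (j + 1) k, ∀ y ∈ Q (j + 1) k, g x = g y)
    (hzero : ∀ k < 2 ^ j, ∫ x in Q j k, g x ∂μ = 0) :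
    (∀ i ≤ j, ∀ x, S i g x = 0) ∧
    (∀ i, j + 1 ≤ i → ∀ x, S i g x = g x) ∧
    (∀ x, Δ j g x = g x) ∧
    (∀ i, i ≠ j → ∀ x, Δ i g x = 0) := by
  have hball (x : PadicInt 2) : ∀ y ∈ dyadicBall (j + 1) x, g y = g x := fun y hy => by
    obtain ⟨k, hk, h⟩ := exists_dyadicBall_eq_Q (j + 1) x
    exact hconst k hk y (h ▸ hy) x (h ▸ self_mem_dyadicBall _ x)
  have hint : Integrable g μ :=
    (continuous_of_const_dyadicBall (j + 1) hball).integrable_of_hasCompactSupport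
      (HasCompactSupport.of_compactSpace g)
  have hlow : ∀ i ≤ j, ∀ x, S i g x = 0 := fun i hi x => by
    rw [S, setIntegral_dyadicBall_eq_zero hint hi, mul_zero]
    intro y
    obtain ⟨k, hk, h⟩ := exists_dyadicBall_eq_Q j y
    rw [h, hzero k hk]
  have hhigh : ∀ i, j + 1 ≤ i → ∀ x, S i g x = g x := fun i hi x =>
    S_eq_self_of_const fun y hy => hball x y (dyadicBall_subset hi x hy)
  refine ⟨hlow, hhigh, fun x => ?_, fun i hi x => ?_⟩
  · rw [Δ, hhigh _ le_rfl, hlow _ le_rfl, sub_zero]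
  · rcases hi.lt_or_gt with h | h
    · rw [Δ, hlow _ h, hlow _ h.le, sub_zero]
    · rw [Δ, hhigh _ (by omega), hhigh _ h, sub_self]
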